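/- There exist Banach spaces X and Y, a 1-net N of X, and a Lipschitz function f : N → Y, such that no uniformly continuous function F : X → Y agrees with f on N; moreover, every uniformly continuous F : X → Y satisfies sup_{x∈N} ‖F(x) − f(x)‖_Y = ∞. -/

import Mathlib

/-- A witness to the main theorem: Banach spaces `X`, `Y`, a `1`-net `N` of `X`, and a
Lipschitz function `f : N → Y` such that no uniformly continuous `F : X → Y` agrees with
`f` on `N`; moreover every uniformly continuous `F : X → Y` satisfies
`sup_{x ∈ N} ‖F(x) − f(x)‖ = ∞`. -/
structure NoUniformExtensionWitness where
  X : Type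
  Y : Type
  [instX : NormedAddCommGroup X]
  [instY : NormedAddCommGroup Y]
  [instSX : NormedSpace ℝ X]
  [instSY : NormedSpace ℝ Y]
  [instCX : CompleteSpace X]
  [instCY : CompleteSpace Y]
  /-- the `1`-net -/
  N : Set X
  sep : ∀ x ∈ N, ∀ y ∈ N, x ≠ y → 1 ≤ dist x y
  cover : ∀ x : X, ∃ y ∈ N, dist x y ≤ 1
  /-- the Lipschitz function on the net -/
  f : N → Y
  L : NNReal
  lip : LipschitzWith L f
  /-- no uniformly continuous map extends `f` -/
  no_ext : ∀ F : X → Y, UniformContinuous F → ∃ x : N, F x ≠ f x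
  /-- moreover, every uniformly continuous map is at unbounded distance from `f` on `N` -/
  unbounded : ∀ F : X → Y, UniformContinuous F → ∀ C : ℝ, ∃ x : N, C < ‖F x - f x‖

open scoped ENNReal NNReal

theorem aux_core {n : ℕ} (hn : 0 < n) (w : (Fin n → Bool) → Fin n → ℝ) (D : ℝ)
    (h : ∀ A, ∑ i, w A i ≤ D) :
    ∃ A i, w A i + w (Function.update A i (!A i)) i ≤ 2 * D / n := by
  have hflip : ∀ i : Fin n, ∑ A, w (Function.update A i (!A i)) i = ∑ A, w A i := by
    intro i
    have hinv : Function.Involutive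
        (fun A : Fin n → Bool => Function.update A i (!A i)) := by
      intro A
      simp
    exact Equiv.sum_comp hinv.toPerm (fun A => w A i)
  by_contra! hcon
  have h1 : ∑ _A : Fin n → Bool, ∑ _i : Fin n, (2 * D / n) < ∑ A, ∑ i, (w A i + w (Function.update A i (!A i)) i) := by
    apply Finset.sum_lt_sum_of_nonempty Finset.univ_nonempty
    intro A _
    have : Nonempty (Fin n) := ⟨⟨0, hn⟩⟩
    apply Finset.sum_lt_sum_of_nonempty Finset.univ_nonempty
    intro i _
    exact hcon A i
  have h2 : ∑ A, ∑ i, (w A i + w (Function.update A i (!A i)) i) = 2 * ∑ A, ∑ i, w A i := by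
    simp only [Finset.sum_add_distrib]
    rw [Finset.sum_comm (f := fun A i => w (Function.update A i (!A i)) i)]
    simp only [hflip]
    rw [Finset.sum_comm (f := fun i A => w A i)]
    ring
  have h3 : ∑ A, ∑ i, w A i ≤ ∑ _A : Fin n → Bool, D := Finset.sum_le_sum fun A _ => h A
  have h4 : ∑ i : Fin n, (2 * D / n) = 2 * D := by
    have : (n : ℝ) ≠ 0 := by positivity
    simp
    field_simp
  rw [h2] at h1
  simp only [h4] at h1
  rw [← Finset.mul_sum] at h1
  linarith

theorem aux_net (X : Type) [NormedAddCommGroup X] : ∃ N : Set X,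
    (∀ x ∈ N, ∀ y ∈ N, x ≠ y → 1 ≤ dist x y) ∧ ∀ x : X, ∃ y ∈ N, dist x y ≤ 1 := by
  obtain ⟨N, hN⟩ := zorn_subset {N : Set X | ∀ x ∈ N, ∀ y ∈ N, x ≠ y → 1 ≤ dist x y} (by
    intro c hc hchain
    refine ⟨⋃₀ c, ?_, fun s hs => Set.subset_sUnion_of_mem hs⟩
    rintro x ⟨s, hs, hx⟩ y ⟨t, ht, hy⟩ hxy
    rcases hchain.total hs ht with h | h
    · exact hc ht x (h hx) y hy hxy
    · exact hc hs x hx y (h hy) hxy)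
  refine ⟨N, hN.prop, fun x => ?_⟩
  by_contra! hcon
  have hx : x ∈ N := by
    refine hN.le_of_ge (y := insert x N) ?_ (Set.subset_insert x N) (Set.mem_insert x N)
    rintro a (rfl | ha) b (rfl | hb) hab
    · exact absurd rfl hab
    · exact (hcon b hb).le
    · rw [dist_comm]; exact (hcon a ha).le
    · exact hN.prop a ha b hb hab
  have := hcon x hx
  simp at this
  linarith

theorem aux_chain {X Y : Type} [NormedAddCommGroup X] [NormedSpace ℝ X] [NormedAddCommGroup Y]
    (F : X → Y) (hF : UniformContinuous F) :
    ∃ K : ℝ, ∀ x y, dist x y ≤ 1 → dist (F x) (F y) ≤ K := by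
  obtain ⟨δ, hδ, h⟩ := Metric.uniformContinuous_iff.1 hF 1 one_pos
  obtain ⟨m, hm⟩ := exists_nat_one_div_lt hδ
  refine ⟨(m + 1 : ℕ), fun x y hxy => ?_⟩
  let g : ℕ → X := fun k => x + ((k : ℝ) / (m + 1)) • (y - x)
  have hg0 : g 0 = x := by simp [g]
  have hg1 : g (m + 1) = y := by
    have : ((m : ℝ) + 1) / (m + 1) = 1 := div_self (by positivity)
    simp [g, this]
  have h1 := dist_le_range_sum_dist (fun k => F (g k)) (m + 1)
  simp only [hg0, hg1] at h1
  refine h1.trans ?_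
  calc _ ≤ ∑ i ∈ Finset.range (m + 1), (1 : ℝ) := by
        apply Finset.sum_le_sum
        intro i _
        refine (h ?_).le
        have : g i - g (i + 1) = (-(1 / ((m : ℝ) + 1))) • (y - x) := by
          simp only [g]
          rw [add_sub_add_left_eq_sub, ← sub_smul]
          congr 1
          push_cast
          ring
        rw [dist_eq_norm, this, norm_smul, norm_neg, Real.norm_of_nonneg (by positivity),
          ← dist_eq_norm, dist_comm]
        calc 1 / ((m : ℝ) + 1) * dist x y ≤ 1 / ((m : ℝ) + 1) * 1 := by gcongr
          _ < δ := by simpa using hm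
    _ = _ := by simp

theorem aux_rpow (p : ℕ) (a b : ℝ) :
    |(|a| ^ (1 / ((p : ℝ) + 1)) - |b| ^ (1 / ((p : ℝ) + 1)))| ^ (p + 1) ≤ |a - b| := by
  have hr0 : 0 ≤ 1 / ((p : ℝ) + 1) := by positivity
  have hr1 : 1 / ((p : ℝ) + 1) ≤ 1 := by
    rw [div_le_one (by positivity)]; linarith [(Nat.cast_nonneg p : (0 : ℝ) ≤ p)]
  have key : ∀ a b : ℝ, |a| ^ (1 / ((p : ℝ) + 1)) - |b| ^ (1 / ((p : ℝ) + 1)) ≤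
      |a - b| ^ (1 / ((p : ℝ) + 1)) := by
    intro a b
    have h1 : |a| ≤ |a - b| + |b| := by
      simpa using abs_add_le (a - b) b
    have h2 := Real.rpow_le_rpow (abs_nonneg a) h1 hr0
    have h3 := Real.rpow_add_le_add_rpow (abs_nonneg (a - b)) (abs_nonneg b) hr0 hr1
    linarith
  have h : |(|a| ^ (1 / ((p : ℝ) + 1)) - |b| ^ (1 / ((p : ℝ) + 1)))| ≤
      |a - b| ^ (1 / ((p : ℝ) + 1)) := by
    rw [abs_le]
    refine ⟨?_, key a b⟩
    have := key b a
    rw [abs_sub_comm] at this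
    linarith
  refine (pow_le_pow_left₀ (abs_nonneg _) h (p + 1)).trans (le_of_eq ?_)
  rw [← Real.rpow_natCast, ← Real.rpow_mul (abs_nonneg _)]
  push_cast
  rw [one_div_mul_cancel (by positivity), Real.rpow_one]

def auxN (p : ℕ) : ℕ := 2 * (p + 1) ^ (p + 1)

instance auxFact (p : ℕ) : Fact (1 ≤ ((p + 1 : ℕ) : ℝ≥0∞)) :=
  ⟨by exact_mod_cast Nat.le_add_left 1 p⟩

abbrev AuxX (p : ℕ) : Type := PiLp 1 (fun _ : Fin (auxN p) => ℝ)
abbrev AuxY (p : ℕ) : Type := PiLp ((p + 1 : ℕ) : ℝ≥0∞) (fun _ : Fin (auxN p) => ℝ)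

theorem aux_normY (p : ℕ) (y : AuxY p) : ‖y‖ ^ (p + 1) = ∑ i, |y i| ^ (p + 1) := by
  rw [PiLp.norm_eq_of_nat (p + 1) rfl, ← Real.rpow_natCast, ← Real.rpow_mul (by positivity),
    one_div_mul_cancel (by positivity), Real.rpow_one]
  rfl

noncomputable def auxM (p : ℕ) (x : AuxX p) : AuxY p :=
  WithLp.toLp _ (fun i => |x i| ^ (1 / ((p : ℝ) + 1)))

theorem auxM_sub (p : ℕ) (x y : AuxX p) : ‖auxM p x - auxM p y‖ ≤ max 1 ‖x - y‖ := by
  have h : ‖auxM p x - auxM p y‖ ^ (p + 1) ≤ ‖x - y‖ := by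
    rw [aux_normY, PiLp.norm_eq_of_L1]
    exact Finset.sum_le_sum fun i _ => aux_rpow p (x i) (y i)
  by_contra! hcon
  have h1 : 1 ≤ ‖auxM p x - auxM p y‖ := (le_max_left _ _).trans hcon.le
  have h2 := le_self_pow₀ h1 (Nat.succ_ne_zero p)
  have := (le_max_right 1 ‖x - y‖).trans_lt hcon
  exact absurd (h2.trans h) (not_le.2 this)

theorem auxM_zero (p : ℕ) : auxM p 0 = 0 := by
  ext i
  have : ((p : ℝ) + 1) ≠ 0 := by positivity
  simp [auxM, Real.zero_rpow (inv_ne_zero this)]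

noncomputable def auxBig (x : lp AuxX ∞) : lp AuxY ∞ :=
  ⟨fun p => auxM p (x p), by
    refine memℓp_infty ⟨max 1 ‖x‖, ?_⟩
    rintro _ ⟨p, rfl⟩
    have := auxM_sub p (x p) 0
    rw [auxM_zero, sub_zero, sub_zero] at this
    exact this.trans (max_le_max le_rfl (lp.norm_apply_le_norm (by simp) x p))⟩

theorem auxBig_sub (x y : lp AuxX ∞) : ‖auxBig x - auxBig y‖ ≤ max 1 ‖x - y‖ := by
  refine lp.norm_le_of_forall_le (by positivity) fun p => ?_
  refine (auxM_sub p (x p) (y p)).trans (max_le_max le_rfl ?_)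
  exact lp.norm_apply_le_norm (by simp) (x - y) p

noncomputable def auxPt (p : ℕ) (s : ℝ) (A : Fin (auxN p) → Bool) : AuxX p :=
  WithLp.toLp _ (fun i => if A i then s else 0)

theorem auxPt_flip (p : ℕ) (s : ℝ) (hs : 0 < s) (A : Fin (auxN p) → Bool) (i : Fin (auxN p)) :
    ‖auxPt p s A - auxPt p s (Function.update A i (!A i))‖ = s := by
  rw [PiLp.norm_eq_of_L1, Finset.sum_eq_single i]
  · cases h : A i <;> simp [auxPt, h, abs_of_pos hs]
  · intro j _ hj
    simp [auxPt, Function.update_of_ne hj]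
  · simp

theorem auxM_flip (p : ℕ) (s : ℝ) (hs : 0 < s) (A : Fin (auxN p) → Bool) (i : Fin (auxN p)) :
    |auxM p (auxPt p s A) i - auxM p (auxPt p s (Function.update A i (!A i))) i| =
      s ^ (1 / ((p : ℝ) + 1)) := by
  have h0 : ((p : ℝ) + 1) ≠ 0 := by positivity
  have h1 : 0 < s ^ ((p : ℝ) + 1)⁻¹ := by positivity
  cases h : A i <;>
    simp [auxM, auxPt, h, abs_of_pos hs, Real.zero_rpow (inv_ne_zero h0), abs_of_pos h1]

theorem aux_main (F : lp AuxX ∞ → lp AuxY ∞) (hF : UniformContinuous F) (C : ℝ) 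
    (hC : ∀ x, ‖F x - auxBig x‖ ≤ C) : False := by
  have hC0 : 0 ≤ C := (norm_nonneg _).trans (hC 0)
  obtain ⟨δ, hδ, h⟩ := Metric.uniformContinuous_iff.1 hF (1 / 4) (by norm_num)
  obtain ⟨s, hs, hsδ⟩ := exists_between hδ
  -- choose the exponent
  have hlim : Filter.Tendsto (fun p : ℕ => s ^ (1 / ((p : ℝ) + 1))) Filter.atTop (nhds 1) := by
    have h0 := tendsto_one_div_add_atTop_nhds_zero_nat (𝕜 := ℝ)
    have := (Real.continuousAt_const_rpow hs.ne' (b := 0)).tendsto.comp h0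
    simpa [Function.comp_def] using this
  have he1 := hlim.eventually (lt_mem_nhds (show (3 / 4 : ℝ) < 1 by norm_num))
  obtain ⟨p, hp1, hp2⟩ := (he1.and (Filter.eventually_ge_atTop ⌈8 * C⌉₊)).exists
  have hp3 : 8 * C ≤ (p : ℝ) + 1 := by
    have : 8 * C ≤ (p : ℝ) := (Nat.le_ceil _).trans (by exact_mod_cast hp2)
    linarith
  let x : (Fin (auxN p) → Bool) → lp AuxX ∞ := fun A => lp.single ∞ p (auxPt p s A)
  let v : (Fin (auxN p) → Bool) → AuxY p := fun A => F (x A) p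
  have hx : ∀ A, auxBig (x A) p = auxM p (auxPt p s A) := by
    intro A
    change auxM p (x A p) = _
    rw [lp.single_apply_self]
  have hv : ∀ A, ‖v A - auxM p (auxPt p s A)‖ ≤ C := by
    intro A
    have := (lp.norm_apply_le_norm (by simp) (F (x A) - auxBig (x A)) p).trans (hC (x A))
    rw [← hx]
    exact this
  obtain ⟨A, i, hAi⟩ := aux_core (n := auxN p) (by unfold auxN; positivity)
    (fun A i => |(v A - auxM p (auxPt p s A)) i| ^ (p + 1)) (C ^ (p + 1)) (by
      intro A
      rw [← aux_normY]
      exact pow_le_pow_left₀ (norm_nonneg _) (hv A) _)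
  set B := Function.update A i (!A i) with hB
  have hD : 2 * C ^ (p + 1) / (auxN p : ℝ) = (C / ((p : ℝ) + 1)) ^ (p + 1) := by
    unfold auxN
    push_cast
    rw [div_pow, mul_div_mul_left _ _ two_ne_zero]
  rw [hD] at hAi
  have hq : C / ((p : ℝ) + 1) ≤ 1 / 8 := by
    rw [div_le_iff₀ (by positivity)]; linarith
  have hA : |(v A - auxM p (auxPt p s A)) i| ≤ 1 / 8 := by
    refine le_trans (le_of_pow_le_pow_left₀ (Nat.succ_ne_zero p) (by positivity) ?_) hq
    refine le_trans ?_ hAi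
    exact le_add_of_nonneg_right (by positivity)
  have hB' : |(v B - auxM p (auxPt p s B)) i| ≤ 1 / 8 := by
    refine le_trans (le_of_pow_le_pow_left₀ (Nat.succ_ne_zero p) (by positivity) ?_) hq
    refine le_trans ?_ hAi
    exact le_add_of_nonneg_left (by positivity)
  have hxd : dist (x A) (x B) < δ := by
    rw [dist_eq_norm]
    simp only [x]
    rw [← lp.single_sub, lp.norm_single (by simp), auxPt_flip p s hs]
    exact hsδ
  have hFd := h hxd
  rw [dist_eq_norm] at hFd
  have h1 : ‖v A - v B‖ ≤ ‖F (x A) - F (x B)‖ :=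
    lp.norm_apply_le_norm (by simp) (F (x A) - F (x B)) p
  have h2 : |(v A - v B) i| ≤ ‖v A - v B‖ := PiLp.norm_apply_le (v A - v B) i
  have h3 := auxM_flip p s hs A i
  rw [← hB] at h3
  rw [PiLp.sub_apply] at hA hB' h2
  have h4 : |v A i - v B i| < 1 / 4 := h2.trans_lt (h1.trans_lt hFd)
  rw [abs_le] at hA hB'
  rw [abs_lt] at h4
  have h5 : |auxM p (auxPt p s A) i - auxM p (auxPt p s B) i| ≤ 1 / 2 := by
    rw [abs_le]
    constructor <;> linarith
  linarith

theorem aux_unbounded (N : Set (lp AuxX ∞)) (hN : ∀ x, ∃ y ∈ N, dist x y ≤ 1)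
    (F : lp AuxX ∞ → lp AuxY ∞) (hF : UniformContinuous F) (C : ℝ) :
    ∃ x : N, C < ‖F x - auxBig x‖ := by
  by_contra! hcon
  obtain ⟨K, hK⟩ := aux_chain F hF
  refine aux_main F hF (K + C + 1) fun x => ?_
  obtain ⟨y, hy, hxy⟩ := hN x
  have h1 := hK x y hxy
  have h2 := hcon ⟨y, hy⟩
  have h3 := auxBig_sub y x
  rw [← dist_eq_norm, ← dist_eq_norm, dist_comm y x, max_eq_left hxy] at h3
  rw [← dist_eq_norm] at h2 ⊢
  exact (dist_triangle4 (F x) (F y) (auxBig y) (auxBig x)).trans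
    (add_le_add (add_le_add h1 h2) h3)

/-- There exist Banach spaces `X`, `Y`, a `1`-net `N` of `X` and a Lipschitz `f : N → Y`
such that every `F : X → Y` extending `f` fails to be uniformly continuous, and indeed
every uniformly continuous `F : X → Y` satisfies `sup_{x ∈ N} ‖F(x) − f(x)‖ = ∞`. -/
theorem stmt17 : Nonempty NoUniformExtensionWitness := by
  obtain ⟨N, hsep, hcov⟩ := aux_net (lp AuxX ∞)
  refine ⟨{ X := lp AuxX ∞, Y := lp AuxY ∞, N := N, sep := hsep, cover := hcov,
            f := fun x => auxBig x, L := 1, lip := ?_, no_ext := ?_,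
            unbounded := fun F hF C => aux_unbounded N hcov F hF C }⟩
  · refine LipschitzWith.of_dist_le_mul fun x y => ?_
    by_cases hxy : x = y
    · subst hxy; simp
    · have h1 : 1 ≤ dist (x : lp AuxX ∞) y :=
        hsep x x.2 y y.2 (fun h => hxy (Subtype.ext h))
      have h := auxBig_sub x y
      rw [← dist_eq_norm, ← dist_eq_norm, max_eq_right h1] at h
      rw [NNReal.coe_one, one_mul]
      exact h
  · intro F hF
    obtain ⟨x, hx⟩ := aux_unbounded N hcov F hF 0
    exact ⟨x, fun h => by simp [h] at hx⟩
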